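/- Descent of the TransCLIP z-update. Let N, K ≥ 1, let W be a real N×N positive semi-definite matrix (symmetric with x^⊤Wx ≥ 0 for all x ∈ ℝ^N), and let a_1,…,a_N ∈ ℝ^K. Define on (Δ_K)^N the objective L(z) = Σ_{i=1}^N ( Σ_k z_{i,k} log z_{i,k} − Σ_k a_{i,k} z_{i,k} ) − (1/2) Σ_{i=1}^N Σ_{j=1}^N W_{ij} Σ_k z_{i,k} z_{j,k} (with 0·log 0 = 0). Given any z^l ∈ (Δ_K)^N, define the updated assignments z^{l+1}_i = softmax( a_i + Σ_{j=1}^N W_{ij} z_j^l ) for each i, i.e., z^{l+1}_{i,k} = exp(a_{i,k} + Σ_j W_{ij} z^l_{j,k}) / Σ_{k'} exp(a_{i,k'} + Σ_j W_{ij} z^l_{j,k'}). Then L(z^{l+1}) ≤ L(z^l). In TransCLIP, taking a_{i,k} = λ log ŷ_{i,k} + log p_{i,k} recovers the decoupled assignment update of Eq. (4). -/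

import Mathlib

open Matrix

/-- Tangent-line form of the Gibbs inequality for unnormalized weights. -/
lemma Real.sub_le_mul_log_sub_mul_log {x y : ℝ} (hx : 0 ≤ x) (hy : 0 < y) :
    x - y ≤ x * Real.log x - x * Real.log y := by
  rcases hx.eq_or_lt with rfl | hx
  · simp [hy.le]
  · have h := Real.log_le_sub_one_of_pos (div_pos hy hx)
    rw [Real.log_div hy.ne' hx.ne'] at h
    have h' := mul_le_mul_of_nonneg_left h hx.le
    have e : x * (y / x - 1) = y - x := by field_simp
    rw [e] at h'
    linarith

/-- The softmax of `b` minimizes negative entropy minus the linear form `b` over the simplex. -/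
lemma softmax_entropy_le {ι : Type*} [Fintype ι] [Nonempty ι] (b p z : ι → ℝ)
    (hp : ∀ k, p k = Real.exp (b k) / ∑ k', Real.exp (b k')) (hz : z ∈ stdSimplex ℝ ι) :
    (∑ k, p k * Real.log (p k)) - ∑ k, b k * p k
      ≤ (∑ k, z k * Real.log (z k)) - ∑ k, b k * z k := by
  have hS : 0 < ∑ k', Real.exp (b k') :=
    Finset.sum_pos (fun _ _ => Real.exp_pos _) Finset.univ_nonempty
  set S := ∑ k', Real.exp (b k') with hSdef
  have hpos : ∀ k, 0 < p k := fun k => by rw [hp]; exact div_pos (Real.exp_pos _) hS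
  have hsum : ∑ k, p k = 1 := by
    simp_rw [hp, ← Finset.sum_div, ← hSdef]
    exact div_self hS.ne'
  have hlog : ∀ k, Real.log (p k) = b k - Real.log S := fun k => by
    rw [hp, Real.log_div (Real.exp_pos _).ne' hS.ne', Real.log_exp]
  have hleft : (∑ k, p k * Real.log (p k)) - ∑ k, b k * p k = -Real.log S := by
    rw [← Finset.sum_sub_distrib]
    calc ∑ k, (p k * Real.log (p k) - b k * p k) = ∑ k, p k * (-Real.log S) :=
          Finset.sum_congr rfl fun k _ => by rw [hlog]; ring
      _ = -Real.log S := by rw [← Finset.sum_mul, hsum, one_mul]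
  have hright : ∑ k, (z k * (-Real.log S) + (z k - p k))
      ≤ ∑ k, (z k * Real.log (z k) - b k * z k) := by
    refine Finset.sum_le_sum fun k _ => ?_
    have h := Real.sub_le_mul_log_sub_mul_log (hz.1 k) (hpos k)
    rw [hlog] at h
    linarith
  rw [Finset.sum_add_distrib, ← Finset.sum_mul, Finset.sum_sub_distrib, hz.2, hsum,
    Finset.sum_sub_distrib] at hright
  linarith

/-- A symmetric positive semi-definite quadratic form lies above its tangents. -/
lemma Matrix.IsSymm.two_mul_dotProduct_mulVec_le {n : Type*} [Fintype n] {W : Matrix n n ℝ}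
    (hW : W.IsSymm) (hpsd : ∀ x : n → ℝ, 0 ≤ x ⬝ᵥ (W *ᵥ x)) (x y : n → ℝ) :
    2 * (x ⬝ᵥ (W *ᵥ y)) ≤ x ⬝ᵥ (W *ᵥ x) + y ⬝ᵥ (W *ᵥ y) := by
  have h := hpsd (x - y)
  have hc : y ⬝ᵥ (W *ᵥ x) = x ⬝ᵥ (W *ᵥ y) := by
    rw [Matrix.dotProduct_mulVec, ← Matrix.mulVec_transpose, hW.eq, dotProduct_comm]
  rw [Matrix.mulVec_sub, sub_dotProduct, dotProduct_sub, dotProduct_sub, hc] at h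
  linarith

/-- The pairwise coupling of two assignments, split into one bilinear form per class. -/
lemma Matrix.sum_mul_sum_eq_sum_dotProduct_mulVec {n ι : Type*} [Fintype n] [Fintype ι]
    (W : Matrix n n ℝ) (x y : n → ι → ℝ) :
    ∑ i, ∑ j, W i j * ∑ k, x i k * y j k
      = ∑ k, (fun i => x i k) ⬝ᵥ (W *ᵥ fun j => y j k) := by
  simp_rw [dotProduct, Matrix.mulVec, dotProduct, Finset.mul_sum]
  rw [Finset.sum_comm (s := (Finset.univ : Finset ι))]
  refine Finset.sum_congr rfl fun i _ => ?_
  rw [Finset.sum_comm]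
  exact Finset.sum_congr rfl fun k _ => Finset.sum_congr rfl fun j _ => by ring

/-- Descent of the TransCLIP z-update: one softmax update of all assignment vectors,
obtained by minimizing the majorized objective (with the concave Laplacian term
linearized at `z^l`), does not increase the objective `L`. -/
theorem transclip_z_update_descent
    (N K : ℕ) (hN : 1 ≤ N) (hK : 1 ≤ K)
    (W : Matrix (Fin N) (Fin N) ℝ)
    (hWs : W.IsSymm) (hWpsd : ∀ x : Fin N → ℝ, 0 ≤ x ⬝ᵥ (W *ᵥ x))
    (a : Fin N → Fin K → ℝ)
    (L : (Fin N → Fin K → ℝ) → ℝ)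
    (hL : ∀ z : Fin N → Fin K → ℝ,
      L z = (∑ i, ((∑ k, z i k * Real.log (z i k)) - ∑ k, a i k * z i k))
        - (1 / 2) * ∑ i, ∑ j, W i j * ∑ k, z i k * z j k)
    (zl : Fin N → Fin K → ℝ) (hzl : ∀ i, zl i ∈ stdSimplex ℝ (Fin K))
    (znext : Fin N → Fin K → ℝ)
    (hznext : ∀ i k, znext i k =
      Real.exp (a i k + ∑ j, W i j * zl j k)
        / ∑ k', Real.exp (a i k' + ∑ j, W i j * zl j k')) :
    L znext ≤ L zl := by
  have : Nonempty (Fin K) := ⟨⟨0, hK⟩⟩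
  have hgibbs := Finset.sum_le_sum fun i (_ : i ∈ Finset.univ) =>
    softmax_entropy_le (fun k => a i k + ∑ j, W i j * zl j k) (znext i) (zl i) (hznext i) (hzl i)
  have hsplit : ∀ z : Fin N → Fin K → ℝ,
      ∑ i, ((∑ k, z i k * Real.log (z i k)) - ∑ k, (a i k + ∑ j, W i j * zl j k) * z i k)
        = (∑ i, ((∑ k, z i k * Real.log (z i k)) - ∑ k, a i k * z i k))
          - ∑ k, (fun i => z i k) ⬝ᵥ (W *ᵥ fun j => zl j k) := by
    intro z
    have hcross : ∑ k, (fun i => z i k) ⬝ᵥ (W *ᵥ fun j => zl j k)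
        = ∑ i, ∑ k, (∑ j, W i j * zl j k) * z i k := by
      simp_rw [dotProduct, Matrix.mulVec, dotProduct]
      rw [Finset.sum_comm]
      simp_rw [mul_comm]
    rw [hcross, ← Finset.sum_sub_distrib]
    refine Finset.sum_congr rfl fun i _ => ?_
    simp_rw [add_mul, Finset.sum_add_distrib]
    ring
  have hquad := Finset.sum_le_sum fun k (_ : k ∈ Finset.univ) =>
    hWs.two_mul_dotProduct_mulVec_le hWpsd (fun i => znext i k) (fun i => zl i k)
  rw [← Finset.mul_sum, Finset.sum_add_distrib] at hquad
  rw [hsplit, hsplit] at hgibbs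
  rw [hL, hL, Matrix.sum_mul_sum_eq_sum_dotProduct_mulVec,
    Matrix.sum_mul_sum_eq_sum_dotProduct_mulVec]
  linarith
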